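/- arXiv:2107.14323 — 5 statements merged into one kernel-verified Lean document; each statement's English description precedes it below -/
import Mathlib

section
/- Let r > 0 and 0 ≤ x ≤ 2r. The 2-dimensional Lebesgue measure of the lune B((x,0), r) \ B((0,0), r) in ℝ² equals F(x) = π·r² − 2·r²·arccos(x/(2r)) + (x/2)·√(4r² − x²); equivalently, one half of the area of the symmetric difference of two Euclidean balls of radius r in ℝ² whose centers are at distance x equals F(x). -/
open MeasureTheory Real Metric
open scoped ENNReal

/-- `F r x` is the area of the lune `B((x,0),r) \ B((0,0),r)`. -/
noncomputable def F (r x : ℝ) : ℝ :=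
  π * r ^ 2 - 2 * r ^ 2 * Real.arccos (x / (2 * r)) +
    (x / 2) * Real.sqrt (4 * r ^ 2 - x ^ 2)

theorem integral_two_mul_sqrt_sub_sub_const {r x : ℝ} (hr : 0 < r) (hx0 : 0 ≤ x)
    (hx2 : x ≤ 2 * r) :
    ∫ v in (-√(r ^ 2 - (x / 2) ^ 2))..√(r ^ 2 - (x / 2) ^ 2), (2 * √(r ^ 2 - v ^ 2) - x) =
      2 * r ^ 2 * arccos (x / (2 * r)) - (x / 2) * √(4 * r ^ 2 - x ^ 2) := by
  set h := √(r ^ 2 - (x / 2) ^ 2)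
  have h0 : 0 ≤ h := Real.sqrt_nonneg _
  have hsq : h ^ 2 = r ^ 2 - (x / 2) ^ 2 := Real.sq_sqrt (by nlinarith)
  have hhr : h ≤ r := by nlinarith [sq_nonneg x]
  have key : ∫ v in (-h)..h, (2 * √(r ^ 2 - v ^ 2) - x) =
      (h * √(r ^ 2 - h ^ 2) + r ^ 2 * arcsin (h / r) - x * h) -
        (-h * √(r ^ 2 - (-h) ^ 2) + r ^ 2 * arcsin (-h / r) - x * -h) := by
    refine intervalIntegral.integral_eq_sub_of_hasDerivAt_of_le
      (f := fun v => v * √(r ^ 2 - v ^ 2) + r ^ 2 * arcsin (v / r) - x * v) (by linarith)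
      (by fun_prop) ?_ (Continuous.intervalIntegrable (by fun_prop) _ _)
    intro v hv
    have hvr : 0 < r ^ 2 - v ^ 2 := by nlinarith [hv.1, hv.2]
    have hlt : v / r < 1 := by rw [div_lt_one hr]; linarith [hv.2]
    have hgt : -1 < v / r := by rw [lt_div_iff₀ hr]; linarith [hv.1]
    have d1 : HasDerivAt (fun v => r ^ 2 - v ^ 2) (-(2 * v)) v := by
      simpa using ((hasDerivAt_id v).pow 2).const_sub (r ^ 2)
    have d2 := (hasDerivAt_arcsin hgt.ne' hlt.ne).comp v ((hasDerivAt_id v).div_const r)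
    have d := (((hasDerivAt_id v).mul (d1.sqrt hvr.ne')).add (d2.const_mul (r ^ 2))).sub
      ((hasDerivAt_id v).const_mul x)
    refine d.congr_deriv ?_
    have hs : √(1 - (v / r) ^ 2) = √(r ^ 2 - v ^ 2) / r := by
      rw [show 1 - (v / r) ^ 2 = (r ^ 2 - v ^ 2) / r ^ 2 by field_simp, Real.sqrt_div hvr.le,
        Real.sqrt_sq hr.le]
    have hpos : 0 < √(r ^ 2 - v ^ 2) := Real.sqrt_pos.2 hvr
    have hs2 : √(r ^ 2 - v ^ 2) ^ 2 = r ^ 2 - v ^ 2 := Real.sq_sqrt hvr.le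
    simp only [id, hs]
    field_simp
    linear_combination -hs2
  have e1 : √(r ^ 2 - h ^ 2) = x / 2 := by
    rw [hsq, sub_sub_cancel, Real.sqrt_sq (by linarith)]
  have e2 : √(4 * r ^ 2 - x ^ 2) = 2 * h := by
    rw [show 4 * r ^ 2 - x ^ 2 = (2 * h) ^ 2 by rw [mul_pow, hsq]; ring,
      Real.sqrt_sq (by linarith)]
  have e3 : arccos (x / (2 * r)) = arcsin (h / r) := by
    rw [arccos_eq_arcsin (by positivity)]
    congr 1
    rw [show 1 - (x / (2 * r)) ^ 2 = (h / r) ^ 2 by rw [div_pow h, hsq]; field_simp,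
      Real.sqrt_sq (by positivity)]
  rw [key, neg_sq, e1, e2, e3, neg_div, arcsin_neg]
  ring

theorem half_le_sqrt_sub_sq {r x v : ℝ} (hx0 : 0 ≤ x) (hx2 : x ≤ 2 * r)
    (hv : |v| ≤ √(r ^ 2 - (x / 2) ^ 2)) : x / 2 ≤ √(r ^ 2 - v ^ 2) := by
  rw [Real.le_sqrt (abs_nonneg v) (by nlinarith), sq_abs] at hv
  exact Real.le_sqrt_of_sq_le (by linarith)

/-- The intersection of two discs, in the coordinates along and across the common chord. -/
theorem ball_single_inter_ball_zero_eq_preimage_regionBetween {r x : ℝ} (hr : 0 < r)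
    (hx0 : 0 ≤ x) :
    ball (EuclideanSpace.single (1 : Fin 2) x) r ∩ ball (0 : EuclideanSpace ℝ (Fin 2)) r =
      (fun p => MeasurableEquiv.finTwoArrow (WithLp.ofLp p)) ⁻¹'
        regionBetween (fun v => x - √(r ^ 2 - v ^ 2)) (fun v => √(r ^ 2 - v ^ 2))
          (Set.Ioc (-√(r ^ 2 - (x / 2) ^ 2)) √(r ^ 2 - (x / 2) ^ 2)) := by
  ext p
  have hb : ∀ v u : ℝ, √(v ^ 2 + u ^ 2) < r ↔ |u| < √(r ^ 2 - v ^ 2) := fun v u => by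
    rw [Real.sqrt_lt' hr, Real.lt_sqrt (abs_nonneg u), sq_abs]
    constructor <;> intro h <;> linarith
  simp only [Set.mem_inter_iff, mem_ball, EuclideanSpace.dist_eq, Fin.sum_univ_two,
    Real.dist_eq, sq_abs, Set.mem_preimage, regionBetween, Set.mem_ofPred_eq, Set.mem_Ioo,
    Set.mem_Ioc, PiLp.single_apply, PiLp.zero_apply, sub_zero, MeasurableEquiv.finTwoArrow_apply,
    zero_ne_one, if_true, if_false, hb, abs_lt]
  constructor
  · rintro ⟨⟨h1, h2⟩, h3, h4⟩
    have h5 : x / 2 < √(r ^ 2 - p.ofLp 0 ^ 2) := by linarith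
    rw [Real.lt_sqrt (by linarith)] at h5
    have h6 : |p.ofLp 0| < √(r ^ 2 - (x / 2) ^ 2) := by
      rw [Real.lt_sqrt (abs_nonneg _), sq_abs]; linarith
    rw [abs_lt] at h6
    exact ⟨⟨h6.1, h6.2.le⟩, by linarith, h4⟩
  · rintro ⟨-, h1, h2⟩
    exact ⟨⟨by linarith, by linarith⟩, by linarith, h2⟩

theorem volume_ball_single_inter_ball_zero {r x : ℝ} (hr : 0 < r) (hx0 : 0 ≤ x)
    (hx2 : x ≤ 2 * r) :
    volume (ball (EuclideanSpace.single (1 : Fin 2) x) r ∩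
        ball (0 : EuclideanSpace ℝ (Fin 2)) r) =
      ENNReal.ofReal
        (2 * r ^ 2 * arccos (x / (2 * r)) - (x / 2) * √(4 * r ^ 2 - x ^ 2)) := by
  have hmp : MeasurePreserving
      (fun p : EuclideanSpace ℝ (Fin 2) => MeasurableEquiv.finTwoArrow (WithLp.ofLp p)) :=
    (volume_preserving_finTwoArrow ℝ).comp (PiLp.volume_preserving_ofLp (Fin 2))
  have hm : MeasurableSet (regionBetween (fun v => x - √(r ^ 2 - v ^ 2))
      (fun v => √(r ^ 2 - v ^ 2))
      (Set.Ioc (-√(r ^ 2 - (x / 2) ^ 2)) √(r ^ 2 - (x / 2) ^ 2))) :=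
    measurableSet_regionBetween (by fun_prop) (by fun_prop) measurableSet_Ioc
  rw [ball_single_inter_ball_zero_eq_preimage_regionBetween hr hx0,
    hmp.measure_preimage hm.nullMeasurableSet, Measure.volume_eq_prod,
    volume_regionBetween_eq_integral (Continuous.integrableOn_Ioc (by fun_prop))
      (Continuous.integrableOn_Ioc (by fun_prop)) measurableSet_Ioc,
    ← integral_two_mul_sqrt_sub_sub_const hr hx0 hx2,
    intervalIntegral.integral_of_le (by linarith [Real.sqrt_nonneg (r ^ 2 - (x / 2) ^ 2)])]
  · congr 2
    ext v
    simp only [Pi.sub_apply]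
    ring
  · intro v hv
    have := half_le_sqrt_sub_sq hx0 hx2 (abs_le.2 ⟨hv.1.le, hv.2⟩)
    linarith

theorem exists_isometryEquiv_measurePreserving_map_map {E : Type*} [NormedAddCommGroup E]
    [InnerProductSpace ℝ E] [FiniteDimensional ℝ E] [MeasurableSpace E] [BorelSpace E]
    {p q p' q' : E} (h : dist p q = dist p' q') :
    ∃ e : E ≃ᵢ E, MeasurePreserving e ∧ e p = p' ∧ e q = q' := by
  have hn : ‖p - q‖ = ‖p' - q'‖ := by rwa [← dist_eq_norm, ← dist_eq_norm]
  let L := (ℝ ∙ ((p - q) - (p' - q')))ᗮ.reflection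
  refine ⟨((IsometryEquiv.subRight q).trans L.toIsometryEquiv).trans
      (IsometryEquiv.addRight q'), ?_, ?_, ?_⟩
  · exact (measurePreserving_add_right volume q').comp
      (L.measurePreserving.comp (measurePreserving_sub_right volume q))
  · simp [L, Submodule.reflection_sub hn]
  · simp

theorem volume_ball_diff_ball_eq_F {r x : ℝ} (hr : 0 < r) (hx0 : 0 ≤ x) (hx2 : x ≤ 2 * r)
    {p q : EuclideanSpace ℝ (Fin 2)} (hpq : dist p q = x) :
    volume (ball p r \ ball q r) = ENNReal.ofReal (F r x) := by
  have hlens : volume (ball p r ∩ ball q r) = ENNReal.ofReal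
      (2 * r ^ 2 * arccos (x / (2 * r)) - (x / 2) * √(4 * r ^ 2 - x ^ 2)) := by
    obtain ⟨e, hmp, hep, heq⟩ := exists_isometryEquiv_measurePreserving_map_map
      (p := EuclideanSpace.single (1 : Fin 2) x) (q := 0) (p' := p) (q' := q)
      (by simp [hpq, abs_of_nonneg hx0])
    rw [← volume_ball_single_inter_ball_zero hr hx0 hx2,
      ← hmp.measure_preimage (isOpen_ball.inter isOpen_ball).measurableSet.nullMeasurableSet,
      Set.preimage_inter, ← hep, ← heq, e.isometry.preimage_ball, e.isometry.preimage_ball]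
  have hnn : 0 ≤ 2 * r ^ 2 * arccos (x / (2 * r)) - (x / 2) * √(4 * r ^ 2 - x ^ 2) := by
    rw [← integral_two_mul_sqrt_sub_sub_const hr hx0 hx2]
    refine intervalIntegral.integral_nonneg
      (by linarith [Real.sqrt_nonneg (r ^ 2 - (x / 2) ^ 2)]) fun v hv => ?_
    have := half_le_sqrt_sub_sq hx0 hx2 (abs_le.2 hv)
    linarith
  have hball : volume (ball p r) = ENNReal.ofReal (π * r ^ 2) := by
    rw [EuclideanSpace.volume_ball_fin_two, ENNReal.ofReal_mul pi_pos.le,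
      ENNReal.ofReal_pow hr.le, mul_comm]
  rw [← Set.sdiff_self_inter, measure_sdiff Set.inter_subset_left
    (isOpen_ball.inter isOpen_ball).measurableSet.nullMeasurableSet
    (measure_ne_top_of_subset Set.inter_subset_left measure_ball_lt_top.ne),
    hlens, hball, ← ENNReal.ofReal_sub _ hnn, F]
  congr 1
  ring

/-- **Area of a lune.**  For `r > 0` and `0 ≤ x ≤ 2r`, the 2-dimensional Lebesgue
measure of the lune `B((x,0),r) \ B((0,0),r)` in `ℝ²` equals
`F(x) = π r² − 2 r² arccos(x/(2r)) + (x/2) √(4r² − x²)`; equivalently, one half of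
the area of the symmetric difference of two Euclidean balls of radius `r` whose
centers are at distance `x` equals `F(x)`. -/
theorem lune_area (r x : ℝ) (hr : 0 < r) (hx0 : 0 ≤ x) (hx2 : x ≤ 2 * r) :
    volume (ball (EuclideanSpace.single (0 : Fin 2) x) r \
        ball (0 : EuclideanSpace ℝ (Fin 2)) r) = ENNReal.ofReal (F r x) ∧
      ∀ p q : EuclideanSpace ℝ (Fin 2), dist p q = x →
        volume (symmDiff (ball p r) (ball q r)) = ENNReal.ofReal (2 * F r x) := by
  refine ⟨volume_ball_diff_ball_eq_F hr hx0 hx2 (by simp [abs_of_nonneg hx0]), fun p q hpq => ?_⟩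
  rw [measure_symmDiff_eq isOpen_ball.measurableSet.nullMeasurableSet
      isOpen_ball.measurableSet.nullMeasurableSet,
    volume_ball_diff_ball_eq_F hr hx0 hx2 hpq,
    volume_ball_diff_ball_eq_F hr hx0 hx2 (dist_comm q p ▸ hpq), ← two_mul,
    ENNReal.ofReal_mul zero_le_two, ENNReal.ofReal_ofNat]
end

section
/- Let r > 0 and let F(x) = π·r² − 2·r²·arccos(x/(2r)) + (x/2)·√(4r² − x²) for 0 ≤ x ≤ 2r. Then for all 0 ≤ x₁ ≤ x₂ ≤ 2r, F(x₂) ≥ F(x₁) + (x₂ − x₁)·(√(4r² − x₁²) + √(4r² − x₂²))/2. (Here √(4r² − x²) is the derivative F′(x).) -/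
open Real

lemma sqrt_four_mul_sq_sub_sq {r a : ℝ} (hr : 0 < r) (ha : a ∈ Set.Icc (-(π / 2)) (π / 2)) :
    Real.sqrt (4 * r ^ 2 - (2 * r * sin a) ^ 2) = 2 * r * cos a := by
  have hcos := cos_nonneg_of_mem_Icc ha
  rw [← Real.sqrt_sq (show 0 ≤ 2 * r * cos a by positivity)]
  congr 1
  linear_combination (-4 * r ^ 2) * sin_sq_add_cos_sq a

/-- With `x = 2 r sin a`, the function `F` becomes `2 r² (a + sin a cos a)`. -/
lemma F_two_mul_sin {r a : ℝ} (hr : 0 < r) (ha : a ∈ Set.Icc (-(π / 2)) (π / 2)) :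
    F r (2 * r * sin a) = 2 * r ^ 2 * (a + sin a * cos a) := by
  have hsqrt := sqrt_four_mul_sq_sub_sq hr ha
  have hdiv : 2 * r * sin a / (2 * r) = sin a := by field_simp
  rw [F, hsqrt, hdiv, arccos, arcsin_sin ha.1 ha.2]
  ring

lemma two_mul_mul_sin_arcsin_div {r x : ℝ} (hr : 0 < r) (h0 : 0 ≤ x) (h2 : x ≤ 2 * r) :
    2 * r * sin (arcsin (x / (2 * r))) = x := by
  have hle : x / (2 * r) ≤ 1 := (div_le_one (by positivity)).2 h2
  have hge : 0 ≤ x / (2 * r) := by positivity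
  rw [sin_arcsin (by linarith) hle]
  field_simp

/-- **A mean-value inequality for the concave-derivative function `F`.**
For all `0 ≤ x₁ ≤ x₂ ≤ 2r`,
`F(x₂) ≥ F(x₁) + (x₂ − x₁) (√(4r² − x₁²) + √(4r² − x₂²))/2`,
where `√(4r² − x²)` is the derivative `F′(x)`. -/
theorem F_concave_MVT (r x₁ x₂ : ℝ) (hr : 0 < r)
    (h0 : 0 ≤ x₁) (h12 : x₁ ≤ x₂) (h2 : x₂ ≤ 2 * r) :
    F r x₁ + (x₂ - x₁) *
        (Real.sqrt (4 * r ^ 2 - x₁ ^ 2) + Real.sqrt (4 * r ^ 2 - x₂ ^ 2)) / 2 ≤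
      F r x₂ := by
  have hx₁ := two_mul_mul_sin_arcsin_div hr h0 (h12.trans h2)
  have hx₂ := two_mul_mul_sin_arcsin_div hr (h0.trans h12) h2
  have hab : arcsin (x₁ / (2 * r)) ≤ arcsin (x₂ / (2 * r)) := by gcongr
  have ha := arcsin_mem_Icc (x₁ / (2 * r))
  have hb := arcsin_mem_Icc (x₂ / (2 * r))
  generalize arcsin (x₁ / (2 * r)) = a at *
  generalize arcsin (x₂ / (2 * r)) = b at *
  subst hx₁ hx₂
  rw [F_two_mul_sin hr ha, F_two_mul_sin hr hb, sqrt_four_mul_sq_sub_sq hr ha,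
    sqrt_four_mul_sq_sub_sq hr hb]
  have hsin : sin (b - a) ≤ b - a := sin_le (sub_nonneg.2 hab)
  rw [sin_sub] at hsin
  linear_combination (2 * r ^ 2) * hsin
end

section
/- Let B₁, B₂ be two overlapping Euclidean balls in ℝ² of radii r₁ and r₂ respectively, with centers at distance d, and let L = B₁ ∩ B₂. Let δ = min{r₁ + r₂ − d, 2r₁, 2r₂} be the width of L. Then there exist absolute constants c, C > 0 such that the area A of L satisfies c·δ^{3/2}·min{r₁, r₂}^{1/2} ≤ A ≤ C·δ^{3/2}·min{r₁, r₂}^{1/2}. -/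
open MeasureTheory Metric
open scoped ENNReal

/-- Every vector of the plane is a nonnegative multiple of the first vector of some orthonormal
basis. -/
lemma exists_orthonormalBasis_eq_norm_smul (w : EuclideanSpace ℝ (Fin 2)) :
    ∃ e : OrthonormalBasis (Fin 2) ℝ (EuclideanSpace ℝ (Fin 2)), w = ‖w‖ • e 0 := by
  obtain ⟨u, hu, hw⟩ : ∃ u : EuclideanSpace ℝ (Fin 2), ‖u‖ = 1 ∧ w = ‖w‖ • u := by
    by_cases h : w = 0
    · exact ⟨EuclideanSpace.single 0 1, by simp, by simp [h]⟩
    · have hn : ‖w‖ ≠ 0 := norm_ne_zero_iff.mpr h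
      exact ⟨‖w‖⁻¹ • w, by simp [norm_smul, hn], by rw [smul_smul, mul_inv_cancel₀ hn, one_smul]⟩
  have ho : Orthonormal ℝ (({0} : Set (Fin 2)).domRestrict fun _ => u) :=
    ⟨fun _ => hu, fun i j hij => absurd (Subsingleton.elim i j) hij⟩
  obtain ⟨e, he⟩ := ho.exists_orthonormalBasis_extension_of_card_eq (by simp)
  exact ⟨e, by rw [he 0 rfl]; exact hw⟩

/-- Cartesian coordinates centered at `p` whose first axis points towards `q`. -/
lemma exists_measurePreserving_coordinates (p q : EuclideanSpace ℝ (Fin 2)) :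
    ∃ φ : EuclideanSpace ℝ (Fin 2) → Fin 2 → ℝ, MeasurePreserving φ ∧ ∀ x,
      dist x p ^ 2 = φ x 0 ^ 2 + φ x 1 ^ 2 ∧
      dist x q ^ 2 = (φ x 0 - dist p q) ^ 2 + φ x 1 ^ 2 := by
  obtain ⟨e, he⟩ := exists_orthonormalBasis_eq_norm_smul (q - p)
  refine ⟨fun x => WithLp.ofLp (e.repr (x - p)), ?_, fun x => ⟨?_, ?_⟩⟩
  · exact (PiLp.volume_preserving_ofLp (Fin 2)).comp
      (e.measurePreserving_repr.comp (measurePreserving_sub_right volume p))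
  · rw [dist_eq_norm, ← e.repr.norm_map, EuclideanSpace.real_norm_sq_eq, Fin.sum_univ_two]
  · have hq : x - q = (x - p) - dist p q • e 0 := by
      rw [dist_comm, dist_eq_norm, ← he]; abel
    rw [dist_eq_norm, hq, ← e.repr.norm_map, EuclideanSpace.real_norm_sq_eq, Fin.sum_univ_two]
    simp

lemma volume_real_preimage_box {φ : EuclideanSpace ℝ (Fin 2) → Fin 2 → ℝ}
    (hφ : MeasurePreserving φ) {a b h : ℝ} (hab : a ≤ b) (hh : 0 ≤ h) :
    (volume (φ ⁻¹' Set.univ.pi fun i => Set.Ioo (![a, -h] i) (![b, h] i))).toReal =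
      (b - a) * (2 * h) := by
  rw [hφ.measure_preimage
    (MeasurableSet.univ_pi fun _ => measurableSet_Ioo).nullMeasurableSet,
    Real.volume_pi_Ioo_toReal]
  · simp [Fin.prod_univ_two, two_mul]
  · intro i; fin_cases i <;> simp <;> linarith

lemma mem_preimage_box {φ : EuclideanSpace ℝ (Fin 2) → Fin 2 → ℝ} {a b h : ℝ}
    {x : EuclideanSpace ℝ (Fin 2)} :
    x ∈ (φ ⁻¹' Set.univ.pi fun i => Set.Ioo (![a, -h] i) (![b, h] i)) ↔
      (a < φ x 0 ∧ φ x 0 < b) ∧ |φ x 1| < h := by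
  simp [Fin.forall_fin_two, abs_lt]

lemma volume_ball_inter_ball_ne_top (p q : EuclideanSpace ℝ (Fin 2)) (r R : ℝ) :
    volume (ball p r ∩ ball q R) ≠ ⊤ :=
  measure_ne_top_of_subset Set.inter_subset_left measure_ball_lt_top.ne

lemma volume_ball_inter_ball_le {p q : EuclideanSpace ℝ (Fin 2)} {r R δ : ℝ} (hr : 0 < r)
    (hR : 0 < R) (hδ : 0 < δ) (hδ_eq : δ = min (r + R - dist p q) (2 * r)) :
    (volume (ball p r ∩ ball q R)).toReal ≤ δ * (2 * √(2 * r * δ)) := by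
  obtain ⟨φ, hφ, hdist⟩ := exists_measurePreserving_coordinates p q
  have hbox := volume_real_preimage_box hφ (sub_le_self r hδ.le) (Real.sqrt_nonneg (2 * r * δ))
  rw [sub_sub_cancel] at hbox
  rw [← hbox]
  refine ENNReal.toReal_mono ?_ (measure_mono fun x hx => ?_)
  · intro htop
    rw [htop, ENNReal.toReal_top] at hbox
    have : 0 < δ * (2 * √(2 * r * δ)) := by positivity
    linarith
  · obtain ⟨hp, hq⟩ := hdist x
    have h1 : dist x p ^ 2 < r ^ 2 := pow_lt_pow_left₀ hx.1 dist_nonneg two_ne_zero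
    have h2 : dist x q ^ 2 < R ^ 2 := pow_lt_pow_left₀ hx.2 dist_nonneg two_ne_zero
    rw [hp] at h1
    rw [hq] at h2
    have h3 := abs_lt.mp (abs_lt_of_sq_lt_sq (a := φ x 0) (by nlinarith [sq_nonneg (φ x 1)]) hr.le)
    have h4 := abs_lt.mp (abs_lt_of_sq_lt_sq (a := φ x 0 - dist p q)
      (by nlinarith [sq_nonneg (φ x 1)]) hR.le)
    have h5 : r - δ < φ x 0 := by
      rcases min_choice (r + R - dist p q) (2 * r) with h | h <;> rw [h] at hδ_eq <;> linarith
    refine mem_preimage_box.mpr ⟨⟨h5, h3.2⟩, Real.lt_sqrt_of_sq_lt ?_⟩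
    rw [sq_abs]
    nlinarith [mul_pos (sub_pos.mpr h3.2) (sub_pos.mpr h3.2),
      mul_pos hr (sub_pos.mpr h5)]

lemma le_volume_ball_inter_ball {p q : EuclideanSpace ℝ (Fin 2)} {r R δ : ℝ} (hr : 0 < r)
    (hrR : r ≤ R) (hδ : 0 < δ) (hδ_eq : δ = min (r + R - dist p q) (2 * r)) :
    δ * √(r * δ / 8) ≤ (volume (ball p r ∩ ball q R)).toReal := by
  obtain ⟨φ, hφ, hdist⟩ := exists_measurePreserving_coordinates p q
  have hbox := volume_real_preimage_box hφ (a := r - 3 * δ / 4) (b := r - δ / 4) (by linarith)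
    (Real.sqrt_nonneg (r * δ / 8))
  have harea : δ * √(r * δ / 8) = (r - δ / 4 - (r - 3 * δ / 4)) * (2 * √(r * δ / 8)) := by ring
  rw [harea, ← hbox]
  refine ENNReal.toReal_mono (volume_ball_inter_ball_ne_top p q r R) (measure_mono fun x hx => ?_)
  obtain ⟨⟨ha, hb⟩, hh⟩ := mem_preimage_box.mp hx
  obtain ⟨hp, hq⟩ := hdist x
  have hh2 : φ x 1 ^ 2 < r * δ / 8 := by
    rw [← sq_abs]
    exact (Real.lt_sqrt (abs_nonneg _)).mp hh
  have hd : 0 ≤ dist p q := dist_nonneg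
  have hδ1 : δ ≤ r + R - dist p q := hδ_eq ▸ min_le_left _ _
  have hδ2 : δ ≤ 2 * r := hδ_eq ▸ min_le_right _ _
  have hfar : r / 2 ≤ R + dist p q - φ x 0 := by
    rcases min_choice (r + R - dist p q) (2 * r) with h | h <;> rw [h] at hδ_eq <;> linarith
  refine ⟨lt_of_pow_lt_pow_left₀ 2 hr.le ?_, lt_of_pow_lt_pow_left₀ 2 (hr.le.trans hrR) ?_⟩
  · rw [hp]
    have := mul_le_mul (show δ / 4 ≤ r - φ x 0 by linarith)
      (show r / 2 ≤ r + φ x 0 by linarith) (by positivity) (by linarith)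
    linarith
  · rw [hq]
    have := mul_le_mul (show δ / 4 ≤ R - dist p q + φ x 0 by linarith) hfar
      (by positivity) (by linarith)
    linarith

lemma volume_ball_inter_ball_bounds {p q : EuclideanSpace ℝ (Fin 2)} {r R δ : ℝ} (hr : 0 < r)
    (hrR : r ≤ R) (hδ : 0 < δ) (hδ_eq : δ = min (r + R - dist p q) (2 * r)) :
    √(1 / 8) * δ ^ ((3 : ℝ) / 2) * √r ≤ (volume (ball p r ∩ ball q R)).toReal ∧
    (volume (ball p r ∩ ball q R)).toReal ≤ 2 * √2 * δ ^ ((3 : ℝ) / 2) * √r := by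
  have hpow : δ ^ ((3 : ℝ) / 2) = δ * √δ := by
    rw [Real.sqrt_eq_rpow, ← Real.rpow_one_add' hδ.le (by norm_num)]
    norm_num
  rw [hpow]
  constructor
  · convert le_volume_ball_inter_ball hr hrR hδ hδ_eq using 1
    rw [show r * δ / 8 = 1 / 8 * δ * r by ring, Real.sqrt_mul (by positivity),
      Real.sqrt_mul (by positivity)]
    ring
  · convert volume_ball_inter_ball_le hr (hr.trans_le hrR) hδ hδ_eq using 1
    rw [Real.sqrt_mul (by positivity), Real.sqrt_mul (by positivity)]
    ring

/-- **Width–area relation for a lens in the plane.**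
There are absolute constants `c, C > 0` such that whenever `B₁, B₂` are overlapping
Euclidean balls in `ℝ²` of radii `r₁, r₂` with centers at distance `d`, and
`δ = min{r₁ + r₂ − d, 2r₁, 2r₂}` is the width of the lens `L = B₁ ∩ B₂`, the area
`A` of `L` satisfies `c δ^{3/2} min{r₁,r₂}^{1/2} ≤ A ≤ C δ^{3/2} min{r₁,r₂}^{1/2}`. -/
theorem lens_width_area :
    ∃ c C : ℝ, 0 < c ∧ 0 < C ∧
      ∀ (p q : EuclideanSpace ℝ (Fin 2)) (r₁ r₂ : ℝ), 0 < r₁ → 0 < r₂ →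
        dist p q < r₁ + r₂ →
        c * (min (r₁ + r₂ - dist p q) (min (2 * r₁) (2 * r₂))) ^ ((3 : ℝ) / 2) *
            Real.sqrt (min r₁ r₂) ≤
          (volume (ball p r₁ ∩ ball q r₂)).toReal ∧
        (volume (ball p r₁ ∩ ball q r₂)).toReal ≤
          C * (min (r₁ + r₂ - dist p q) (min (2 * r₁) (2 * r₂))) ^ ((3 : ℝ) / 2) *
            Real.sqrt (min r₁ r₂) := by
  refine ⟨√(1 / 8), 2 * √2, by positivity, by positivity, fun p q r₁ r₂ h₁ h₂ hd => ?_⟩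
  have hδ : 0 < min (r₁ + r₂ - dist p q) (min (2 * r₁) (2 * r₂)) :=
    lt_min (by linarith) (lt_min (by linarith) (by linarith))
  rcases le_total r₁ r₂ with h | h
  · rw [min_eq_left h]
    exact volume_ball_inter_ball_bounds h₁ h hδ (by rw [min_eq_left (by linarith : 2 * r₁ ≤ 2 * r₂)])
  · rw [min_eq_right h, Set.inter_comm]
    exact volume_ball_inter_ball_bounds h₂ h hδ
      (by rw [min_eq_right (by linarith : 2 * r₂ ≤ 2 * r₁), dist_comm p q, add_comm r₁ r₂])
end

section
/- Let x, y, z ∈ ℝ² form an acute triangle (all interior angles less than π/2) with minimum side length at least ℓ > 0. Let u, u′ ∈ ℝ² and ε′ ≥ 0, D > 0 be such that for each v ∈ {x, y, z}, ‖u − v‖ ≤ D, ‖u′ − v‖ ≤ D, and |‖u − v‖ − ‖u′ − v‖| ≤ ε′. Then ‖u − u′‖ ≤ 4√2·D·ε′/ℓ. -/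
open Real EuclideanGeometry

theorem EuclideanSpace.dist_sq_fin_two (p q : EuclideanSpace ℝ (Fin 2)) :
    dist p q ^ 2 = (p 0 - q 0) ^ 2 + (p 1 - q 1) ^ 2 := by
  rw [EuclideanSpace.dist_eq, Real.sq_sqrt (Finset.sum_nonneg fun _ _ => sq_nonneg _)]
  simp [Fin.sum_univ_two, Real.dist_eq, sq_abs]

theorem EuclideanGeometry.dot_pos_of_angle_lt_pi_div_two {a b c : EuclideanSpace ℝ (Fin 2)}
    (h : EuclideanGeometry.angle a b c < π / 2) :
    0 < (a 0 - b 0) * (c 0 - b 0) + (a 1 - b 1) * (c 1 - b 1) := by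
  have hcos : 0 < Real.cos (InnerProductGeometry.angle (a - b) (c - b)) :=
    Real.cos_pos_of_mem_Ioo
      ⟨by linarith [InnerProductGeometry.angle_nonneg (a - b) (c - b), Real.pi_pos], h⟩
  rw [InnerProductGeometry.cos_angle] at hcos
  have hinner : 0 < inner ℝ (a - b) (c - b) :=
    pos_of_mul_pos_left hcos (inv_nonneg.2 (by positivity))
  simp only [PiLp.inner_apply, Fin.sum_univ_two, PiLp.sub_apply, RCLike.inner_apply,
    conj_trivial] at hinner
  linarith

theorem abs_sq_sub_sq_le {s t D ε : ℝ} (hs : 0 ≤ s) (ht : 0 ≤ t) (hsD : s ≤ D) (htD : t ≤ D)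
    (h : |s - t| ≤ ε) : |s ^ 2 - t ^ 2| ≤ 2 * D * ε := by
  rw [sq_sub_sq, abs_mul, abs_of_nonneg (add_nonneg hs ht)]
  exact mul_le_mul (by linarith) h (abs_nonneg _) (by linarith)

/-- If `w` has inner products at most `M` in absolute value with the three edges of an acute
triangle with edge vectors `a`, `b`, `a - b` of length at least `|l|`, then `l ^ 2 * ‖w‖ ^ 2 ≤ 2 * M ^ 2`. -/
theorem sq_mul_sq_norm_le_of_acute {a₀ a₁ b₀ b₁ w₀ w₁ l M : ℝ}
    (hα : 0 < a₀ * b₀ + a₁ * b₁)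
    (hβ : 0 < a₀ ^ 2 + a₁ ^ 2 - (a₀ * b₀ + a₁ * b₁))
    (hγ : 0 < b₀ ^ 2 + b₁ ^ 2 - (a₀ * b₀ + a₁ * b₁))
    (ha : l ^ 2 ≤ a₀ ^ 2 + a₁ ^ 2) (hb : l ^ 2 ≤ b₀ ^ 2 + b₁ ^ 2)
    (hab : l ^ 2 ≤ (a₀ - b₀) ^ 2 + (a₁ - b₁) ^ 2)
    (hwa : |a₀ * w₀ + a₁ * w₁| ≤ M) (hwb : |b₀ * w₀ + b₁ * w₁| ≤ M)
    (hwab : |(a₀ * w₀ + a₁ * w₁) - (b₀ * w₀ + b₁ * w₁)| ≤ M) :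
    l ^ 2 * (w₀ ^ 2 + w₁ ^ 2) ≤ 2 * M ^ 2 := by
  obtain ⟨α, hα'⟩ : ∃ α, α = a₀ * b₀ + a₁ * b₁ := ⟨_, rfl⟩
  obtain ⟨β, hβ'⟩ : ∃ β, β = a₀ ^ 2 + a₁ ^ 2 - (a₀ * b₀ + a₁ * b₁) := ⟨_, rfl⟩
  obtain ⟨γ, hγ'⟩ : ∃ γ, γ = b₀ ^ 2 + b₁ ^ 2 - (a₀ * b₀ + a₁ * b₁) := ⟨_, rfl⟩
  have hp := sq_le_sq' (abs_le.1 hwa).1 (abs_le.1 hwa).2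
  have hq := sq_le_sq' (abs_le.1 hwb).1 (abs_le.1 hwb).2
  have hpq := sq_le_sq' (abs_le.1 hwab).1 (abs_le.1 hwab).2
  have gram : (w₀ ^ 2 + w₁ ^ 2) * (α * β + β * γ + γ * α) =
      γ * (a₀ * w₀ + a₁ * w₁) ^ 2 + β * (b₀ * w₀ + b₁ * w₁) ^ 2
        + α * ((a₀ * w₀ + a₁ * w₁) - (b₀ * w₀ + b₁ * w₁)) ^ 2 := by
    rw [hα', hβ', hγ']; ring
  rw [← hα'] at hα
  rw [← hβ'] at hβ
  rw [← hγ'] at hγ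
  have hαβ : l ^ 2 ≤ α + β := by linarith
  have hαγ : l ^ 2 ≤ α + γ := by linarith
  have hβγ : l ^ 2 ≤ β + γ := by linarith
  have he : 0 < α * β + β * γ + γ * α := by positivity
  have hS : l ^ 2 * (α + β + γ) ≤ 2 * (α * β + β * γ + γ * α) := by
    linarith [mul_le_mul_of_nonneg_left hαβ hγ.le, mul_le_mul_of_nonneg_left hαγ hβ.le,
      mul_le_mul_of_nonneg_left hβγ hα.le]
  have hform : (w₀ ^ 2 + w₁ ^ 2) * (α * β + β * γ + γ * α) ≤ M ^ 2 * (α + β + γ) := by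
    linarith [mul_le_mul_of_nonneg_left hp hγ.le, mul_le_mul_of_nonneg_left hq hβ.le,
      mul_le_mul_of_nonneg_left hpq hα.le]
  refine le_of_mul_le_mul_right ?_ he
  linarith [mul_le_mul_of_nonneg_left hform (sq_nonneg l),
    mul_le_mul_of_nonneg_left hS (sq_nonneg M)]

/-- **Triangulation from three landmarks.**
Let `x, y, z ∈ ℝ²` form an acute triangle with minimum side length at least
`ℓ > 0`.  Let `u, u′ ∈ ℝ²`, `ε′ ≥ 0` and `D > 0` be such that for each
`v ∈ {x,y,z}` we have `‖u − v‖ ≤ D`, `‖u′ − v‖ ≤ D` and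
`|‖u − v‖ − ‖u′ − v‖| ≤ ε′`.  Then `‖u − u′‖ ≤ 4√2 D ε′ / ℓ`. -/
theorem triangulation_bound (x y z u u' : EuclideanSpace ℝ (Fin 2)) (ℓ ε' D : ℝ)
    (hℓ : 0 < ℓ) (hε' : 0 ≤ ε') (hD : 0 < D)
    (hacute_x : EuclideanGeometry.angle y x z < π / 2)
    (hacute_y : EuclideanGeometry.angle x y z < π / 2)
    (hacute_z : EuclideanGeometry.angle x z y < π / 2)
    (hxy : ℓ ≤ dist x y) (hyz : ℓ ≤ dist y z) (hxz : ℓ ≤ dist x z)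
    (hbound : ∀ v ∈ ({x, y, z} : Set (EuclideanSpace ℝ (Fin 2))),
      dist u v ≤ D ∧ dist u' v ≤ D ∧ |dist u v - dist u' v| ≤ ε') :
    dist u u' ≤ 4 * Real.sqrt 2 * D * ε' / ℓ := by
  have hx := hbound x (by simp)
  have hy := hbound y (by simp)
  have hz := hbound z (by simp)
  have key {v} (h : dist u v ≤ D ∧ dist u' v ≤ D ∧ |dist u v - dist u' v| ≤ ε') :=
    abs_le.1 (abs_sq_sub_sq_le dist_nonneg dist_nonneg h.1 h.2.1 h.2.2)
  have kx := key hx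
  have ky := key hy
  have kz := key hz
  have sxy := pow_le_pow_left₀ hℓ.le hxy 2
  have syz := pow_le_pow_left₀ hℓ.le hyz 2
  have sxz := pow_le_pow_left₀ hℓ.le hxz 2
  simp only [EuclideanSpace.dist_sq_fin_two] at kx ky kz sxy syz sxz
  have ax := dot_pos_of_angle_lt_pi_div_two hacute_x
  have ay := dot_pos_of_angle_lt_pi_div_two hacute_y
  have az := dot_pos_of_angle_lt_pi_div_two hacute_z
  have hw := sq_mul_sq_norm_le_of_acute (a₀ := y 0 - x 0) (a₁ := y 1 - x 1) (b₀ := z 0 - x 0)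
    (b₁ := z 1 - x 1) (w₀ := u 0 - u' 0) (w₁ := u 1 - u' 1) (l := ℓ) (M := 2 * D * ε')
    ax (by linarith) (by linarith) (by linarith) (by linarith) (by linarith)
    (abs_le.2 ⟨by linarith, by linarith⟩) (abs_le.2 ⟨by linarith, by linarith⟩)
    (abs_le.2 ⟨by linarith, by linarith⟩)
  rw [← EuclideanSpace.dist_sq_fin_two] at hw
  rw [le_div_iff₀ hℓ]
  refine abs_le_of_sq_le_sq' ?_ (by positivity) |>.2
  have h2 : Real.sqrt 2 ^ 2 = 2 := Real.sq_sqrt (by norm_num)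
  have : (4 * Real.sqrt 2 * D * ε') ^ 2 = 32 * (D * ε') ^ 2 := by
    rw [mul_assoc, mul_pow, mul_pow, h2]; ring
  rw [this]
  linarith [sq_nonneg (D * ε')]
end

section
/- Let m ≥ 2 be a fixed integer and let B₁, B₂ be two overlapping Euclidean balls in ℝ^m of radii r₁ ≤ r₂ whose centers are at distance d, and let L = B₁ ∩ B₂ with width ε = min{r₁ + r₂ − d, 2r₁}. Then there exist constants c_m, C_m > 0 depending only on m such that the m-dimensional volume V of L satisfies c_m·√(ε^{m+1}·r₁^{m−1}) ≤ V ≤ C_m·√(ε^{m+1}·r₁^{m−1}). -/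
open MeasureTheory Metric
open scoped ENNReal

/-- A vector is a multiple, by its norm, of the first vector of some orthonormal basis. -/
lemma exists_orthonormalBasis_norm_smul_eq {n : ℕ} (v : EuclideanSpace ℝ (Fin (n + 1))) :
    ∃ b : OrthonormalBasis (Fin (n + 1)) ℝ (EuclideanSpace ℝ (Fin (n + 1))),
      v = ‖v‖ • b 0 := by
  by_cases hv : v = 0
  · exact ⟨EuclideanSpace.basisFun _ ℝ, by simp [hv]⟩
  have hv' : ‖v‖ ≠ 0 := norm_ne_zero_iff.2 hv
  have ho : Orthonormal ℝ (Set.domRestrict {(0 : Fin (n + 1))}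
      (fun _ : Fin (n + 1) => (‖v‖⁻¹ • v : EuclideanSpace ℝ (Fin (n + 1))))) := by
    constructor
    · intro i
      rw [Set.domRestrict_apply, norm_smul, norm_inv, norm_norm, inv_mul_cancel₀ hv']
    · intro i j hij
      exact absurd (Subsingleton.elim i j) hij
  obtain ⟨b, hb⟩ := ho.exists_orthonormalBasis_extension_of_card_eq (by simp)
  refine ⟨b, ?_⟩
  rw [hb 0 rfl, smul_smul, mul_inv_cancel₀ hv', one_smul]

namespace OrthonormalBasis

variable {n : ℕ} (b : OrthonormalBasis (Fin (n + 1)) ℝ (EuclideanSpace ℝ (Fin (n + 1))))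

/-- The points whose coordinates about `p` in the basis `b` lie in
`(α, β)` for the first one and in `(-s, s)` for the others. -/
def box (p : EuclideanSpace ℝ (Fin (n + 1))) (α β s : ℝ) :
    Set (EuclideanSpace ℝ (Fin (n + 1))) :=
  {x | b.repr (x - p) 0 ∈ Set.Ioo α β ∧ ∀ i : Fin n, b.repr (x - p) i.succ ∈ Set.Ioo (-s) s}

lemma volume_box (p : EuclideanSpace ℝ (Fin (n + 1))) {α β s : ℝ} (h : α ≤ β) (hs : 0 ≤ s) :
    volume (b.box p α β s) = ENNReal.ofReal ((β - α) * (2 * s) ^ n) := by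
  have hφ : MeasurePreserving
      (fun x => WithLp.ofLp (b.repr (x - p)) :
        EuclideanSpace ℝ (Fin (n + 1)) → Fin (n + 1) → ℝ) volume volume :=
    (PiLp.volume_preserving_ofLp (Fin (n + 1))).comp
      (b.measurePreserving_repr.comp (measurePreserving_sub_right volume p))
  have hbox : b.box p α β s = (fun x => WithLp.ofLp (b.repr (x - p))) ⁻¹'
      Set.univ.pi (fun i => Set.Ioo ((Fin.cons α fun _ => -s : Fin (n + 1) → ℝ) i)
        ((Fin.cons β fun _ => s : Fin (n + 1) → ℝ) i)) := by
    ext x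
    simp [box, Fin.forall_fin_succ]
  rw [hbox, hφ.measure_preimage
    (MeasurableSet.univ_pi fun _ => measurableSet_Ioo).nullMeasurableSet, Real.volume_pi_Ioo,
    ← ENNReal.ofReal_prod_of_nonneg, Fin.prod_univ_succ]
  · simp [two_mul]
  · intro i _
    refine Fin.cases ?_ (fun j => ?_) i
    · simpa using h
    · simpa using by linarith

lemma dist_sq_eq (p x : EuclideanSpace ℝ (Fin (n + 1))) (t : ℝ) :
    dist x (p + t • b 0) ^ 2 =
      (b.repr (x - p) 0 - t) ^ 2 + ∑ i : Fin n, b.repr (x - p) i.succ ^ 2 := by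
  rw [dist_eq_norm, ← sub_sub, ← b.repr.norm_map, EuclideanSpace.norm_sq_eq,
    Fin.sum_univ_succ]
  simp [b.repr_self, Fin.succ_ne_zero]

section Lens

variable {p : EuclideanSpace ℝ (Fin (n + 1))} {d r₁ r₂ ε : ℝ}

lemma lens_subset_box (hr₁ : 0 < r₁) (hr : r₁ ≤ r₂)
    (hε : ε = min (r₁ + r₂ - d) (2 * r₁)) (hε₀ : 0 < ε) :
    ball p r₁ ∩ ball (p + d • b 0) r₂ ⊆ b.box p (r₁ - ε) r₁ (2 * √(ε * r₁)) := by
  rintro x ⟨hx₁, hx₂⟩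
  rw [mem_ball] at hx₁ hx₂
  have h₁ := b.dist_sq_eq p x 0
  have h₂ := b.dist_sq_eq p x d
  rw [zero_smul, add_zero, sub_zero] at h₁
  have hlt₁ := pow_lt_pow_left₀ hx₁ dist_nonneg two_ne_zero
  have hlt₂ := pow_lt_pow_left₀ hx₂ dist_nonneg two_ne_zero
  have hS : 0 ≤ ∑ i : Fin n, b.repr (x - p) i.succ ^ 2 := Finset.sum_nonneg fun _ _ => sq_nonneg _
  have ht := abs_lt_of_sq_lt_sq' (a := b.repr (x - p) 0) (b := r₁) (by linarith) hr₁.le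
  have ht' := abs_lt_of_sq_lt_sq' (a := b.repr (x - p) 0 - d) (b := r₂) (by linarith)
    (hr₁.le.trans hr)
  have hlow : r₁ - ε < b.repr (x - p) 0 := by
    rcases min_choice (r₁ + r₂ - d) (2 * r₁) with h | h <;> rw [hε, h] <;> linarith
  refine ⟨⟨hlow, ht.2⟩, fun i => ?_⟩
  have hi : b.repr (x - p) i.succ ^ 2 ≤ ∑ i : Fin n, b.repr (x - p) i.succ ^ 2 :=
    Finset.single_le_sum (f := fun i : Fin n => b.repr (x - p) i.succ ^ 2)
      (fun _ _ => sq_nonneg _) (Finset.mem_univ i)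
  refine abs_lt_of_sq_lt_sq' ?_ (by positivity)
  rw [mul_pow, Real.sq_sqrt (by positivity)]
  nlinarith [mul_pos (sub_pos.2 hlow) (sub_pos.2 ht.2), mul_pos hε₀ hr₁]

lemma box_subset_lens (hr₁ : 0 < r₁) (hr : r₁ ≤ r₂) (hd : 0 ≤ d)
    (hε : ε = min (r₁ + r₂ - d) (2 * r₁)) (hε₀ : 0 < ε) :
    b.box p (r₁ - 3 / 4 * ε) (r₁ - ε / 4) (√(ε * r₁) / (8 * (n + 1))) ⊆
      ball p r₁ ∩ ball (p + d • b 0) r₂ := by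
  rintro x ⟨⟨hlow, hup⟩, hx⟩
  have h₁ := b.dist_sq_eq p x 0
  have h₂ := b.dist_sq_eq p x d
  rw [zero_smul, add_zero, sub_zero] at h₁
  have hpos : 0 < ε * r₁ := mul_pos hε₀ hr₁
  have hS : ∑ i : Fin n, b.repr (x - p) i.succ ^ 2 ≤ ε * r₁ / 8 := by
    calc ∑ i : Fin n, b.repr (x - p) i.succ ^ 2
        ≤ ∑ _i : Fin n, (√(ε * r₁) / (8 * (n + 1))) ^ 2 :=
          Finset.sum_le_sum fun i _ => sq_le_sq' (hx i).1.le (hx i).2.le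
      _ = ε * r₁ * (n / (8 * (n + 1)) ^ 2) := by
          rw [Finset.sum_const, Finset.card_univ, Fintype.card_fin, nsmul_eq_mul, div_pow,
            Real.sq_sqrt hpos.le]
          ring
      _ ≤ ε * r₁ * (1 / 8) := by
          refine mul_le_mul_of_nonneg_left ?_ hpos.le
          rw [div_le_div_iff₀ (by positivity) (by norm_num)]
          nlinarith [Nat.cast_nonneg (α := ℝ) n]
      _ = ε * r₁ / 8 := by ring
  have hle₁ : ε ≤ r₁ + r₂ - d := hε ▸ min_le_left _ _
  have hle₂ : ε ≤ 2 * r₁ := hε ▸ min_le_right _ _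
  have hup' : r₁ / 2 < r₂ + d - b.repr (x - p) 0 := by
    rcases min_choice (r₁ + r₂ - d) (2 * r₁) with h | h <;> rw [h] at hε <;> linarith
  have hprod {u v : ℝ} (hu : ε / 4 < u) (hv : r₁ / 2 < v) : ε * r₁ / 8 < u * v := by
    nlinarith [mul_lt_mul'' hu hv (by positivity) (by positivity)]
  constructor <;> rw [mem_ball] <;> refine lt_of_pow_lt_pow_left₀ 2 (by linarith) ?_
  · rw [h₁]
    nlinarith [hprod (u := r₁ - b.repr (x - p) 0) (v := r₁ + b.repr (x - p) 0)
      (by linarith) (by linarith)]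
  · rw [h₂]
    nlinarith [hprod (u := r₂ - d + b.repr (x - p) 0) (by linarith) hup']

end Lens

end OrthonormalBasis

lemma Real.sqrt_pow_add_two_mul_pow {a b : ℝ} (ha : 0 ≤ a) (hb : 0 ≤ b) (n : ℕ) :
    √(a ^ (n + 2) * b ^ n) = a * √(a * b) ^ n := by
  rw [Real.sqrt_eq_iff_mul_self_eq (by positivity) (by positivity), eq_comm]
  calc a * √(a * b) ^ n * (a * √(a * b) ^ n) = a ^ 2 * (√(a * b) ^ 2) ^ n := by ring
    _ = a ^ (n + 2) * b ^ n := by rw [Real.sq_sqrt (by positivity)]; ring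

/-- **Width–volume relation for a lens in `ℝ^m`.**
For every fixed `m ≥ 2` there are constants `c_m, C_m > 0` depending only on `m` such
that whenever `B₁, B₂` are overlapping Euclidean balls in `ℝ^m` of radii `r₁ ≤ r₂`
with centers at distance `d`, and `ε = min{r₁ + r₂ − d, 2r₁}` is the width of the lens
`L = B₁ ∩ B₂`, the `m`-dimensional volume `V` of `L` satisfies
`c_m √(ε^{m+1} r₁^{m−1}) ≤ V ≤ C_m √(ε^{m+1} r₁^{m−1})`. -/
theorem lens_width_volume (m : ℕ) (hm : 2 ≤ m) :
    ∃ c C : ℝ, 0 < c ∧ 0 < C ∧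
      ∀ (p q : EuclideanSpace ℝ (Fin m)) (r₁ r₂ : ℝ), 0 < r₁ → r₁ ≤ r₂ →
        dist p q < r₁ + r₂ →
        c * Real.sqrt ((min (r₁ + r₂ - dist p q) (2 * r₁)) ^ (m + 1) * r₁ ^ (m - 1)) ≤
          (volume (ball p r₁ ∩ ball q r₂)).toReal ∧
        (volume (ball p r₁ ∩ ball q r₂)).toReal ≤
          C * Real.sqrt ((min (r₁ + r₂ - dist p q) (2 * r₁)) ^ (m + 1) * r₁ ^ (m - 1)) := by
  obtain ⟨n, rfl⟩ : ∃ n, m = n + 1 := ⟨m - 1, by omega⟩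
  refine ⟨1 / 2 * (2 / (8 * (n + 1))) ^ n, 4 ^ n, by positivity, by positivity, ?_⟩
  intro p q r₁ r₂ hr₁ hr hd
  obtain ⟨b, hb⟩ := exists_orthonormalBasis_norm_smul_eq (q - p)
  obtain ⟨ε, hε⟩ : ∃ ε, ε = min (r₁ + r₂ - dist p q) (2 * r₁) := ⟨_, rfl⟩
  have hε₀ : 0 < ε := hε ▸ lt_min (by linarith) (by linarith)
  have hq : q = p + dist p q • b 0 := by
    rw [dist_comm, dist_eq_norm, ← hb, add_sub_cancel]
  have hupper := b.lens_subset_box (p := p) hr₁ hr hε hε₀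
  have hlower := b.box_subset_lens (p := p) hr₁ hr dist_nonneg hε hε₀
  rw [← hq] at hupper hlower
  rw [← hε, add_tsub_cancel_right, Real.sqrt_pow_add_two_mul_pow hε₀.le hr₁.le]
  constructor
  · have h := ENNReal.toReal_mono (measure_ne_top_of_subset Set.inter_subset_left
      measure_ball_lt_top.ne) (measure_mono (μ := volume) hlower)
    rw [b.volume_box p (by linarith) (by positivity), ENNReal.toReal_ofReal (by
      have : 0 ≤ r₁ - ε / 4 - (r₁ - 3 / 4 * ε) := by linarith
      positivity)] at h
    refine le_of_eq_of_le ?_ h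
    rw [mul_div_assoc', mul_comm 2 (√_), mul_div_assoc, mul_pow]
    ring
  · have hvol := b.volume_box p (α := r₁ - ε) (β := r₁) (s := 2 * √(ε * r₁))
      (by linarith) (by positivity)
    have h := ENNReal.toReal_mono (by rw [hvol]; exact ENNReal.ofReal_ne_top)
      (measure_mono (μ := volume) hupper)
    rw [hvol, sub_sub_cancel, ENNReal.toReal_ofReal (by positivity)] at h
    refine h.trans_eq ?_
    rw [← mul_assoc, mul_pow]
    norm_num
    ring
end
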